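/- arXiv:1512.03306 — 5 statements merged into one kernel-verified Lean document; each statement's English description precedes it below -/
import Mathlib

section
/- Let ℓ be a positive integer and let f₁,…,f_ℓ : ℕ → ℝ≥0 be ascending functions, and define f : ℕ^ℓ → ℝ≥0 by f(x₁,…,x_ℓ) = Σ_{k=1}^{ℓ} f_k(x_k). For each i ∈ ℕ, define S(i) as follows: if for every k the set {y ∈ ℕ : f_k(y) ≤ i} is nonempty, let S(i) = {x(i)} where x(i)_k = max{y ∈ ℕ : f_k(y) ≤ i} (this maximum exists since f_k is ascending); otherwise let S(i) = ∅. Then (S(i))_{i∈ℕ} is a bounded set-sequence for f with bounding constant ℓ, and |S(i)| ≤ 1 for every i. -/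
open scoped NNReal

/-- The sublevel sets of a function on `ℕ` that tends to infinity are bounded above. -/
theorem bddAbove_sublevel_of_tendsto_atTop {g : ℕ → ℝ≥0}
    (hg : Filter.Tendsto g Filter.atTop Filter.atTop) (c : ℝ≥0) :
    BddAbove {y : ℕ | g y ≤ c} := by
  obtain ⟨N, hN⟩ := Filter.eventually_atTop.1 (hg.eventually_gt_atTop c)
  refine ⟨N, fun y hy => ?_⟩
  by_contra! h
  exact (hN y h.le).not_ge hy

/-- For ascending functions `f₁,…,f_ℓ : ℕ → ℝ≥0` and the additive function
`F x = ∑ k, f k (x k)`, the sequence `S i` — defined as the singleton of the coordinatewise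
maxima `x(i)_k = max {y | f_k y ≤ i}` when all these sets are nonempty, and `∅` otherwise —
is a bounded set-sequence for `F` with bounding constant `ℓ`, and `|S i| ≤ 1` for all `i`. -/
theorem stmt0 (ℓ : ℕ) (hℓ : 0 < ℓ) (f : Fin ℓ → ℕ → ℝ≥0)
    (hmono : ∀ k, Monotone (f k))
    (htend : ∀ k, Filter.Tendsto (f k) Filter.atTop Filter.atTop)
    (F : (Fin ℓ → ℕ) → ℝ≥0) (hF : ∀ x, F x = ∑ k, f k (x k))
    (S : ℕ → Finset (Fin ℓ → ℕ))
    (hS : ∀ i : ℕ,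
      ((∀ k, ∃ y : ℕ, f k y ≤ (i : ℝ≥0)) →
        S i = {fun k => sSup {y : ℕ | f k y ≤ (i : ℝ≥0)}}) ∧
      ((¬ ∀ k, ∃ y : ℕ, f k y ≤ (i : ℝ≥0)) → S i = ∅)) :
    (∀ i : ℕ, (S i).card ≤ 1) ∧
    (∀ i : ℕ, ∀ y : Fin ℓ → ℕ, F y ≤ (i : ℝ≥0) → ∃ x ∈ S i, ∀ k, y k ≤ x k) ∧
    (∀ i : ℕ, ∀ x ∈ S i, F x ≤ (ℓ : ℝ≥0) * (i : ℝ≥0)) := by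
  refine ⟨fun i => ?_, fun i y hy => ?_, fun i x hx => ?_⟩
  · by_cases h : ∀ k, ∃ y : ℕ, f k y ≤ (i : ℝ≥0)
    · simp [(hS i).1 h]
    · simp [(hS i).2 h]
  · have hle (k : Fin ℓ) : f k (y k) ≤ (i : ℝ≥0) :=
      (Finset.single_le_sum (f := fun k => f k (y k)) (fun _ _ => zero_le)
        (Finset.mem_univ k)).trans (hF y ▸ hy)
    rw [(hS i).1 fun k => ⟨y k, hle k⟩]
    exact ⟨_, Finset.mem_singleton_self _, fun k =>
      le_csSup (bddAbove_sublevel_of_tendsto_atTop (htend k) i) (hle k)⟩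
  · by_cases h : ∀ k, ∃ y : ℕ, f k y ≤ (i : ℝ≥0)
    · rw [(hS i).1 h, Finset.mem_singleton] at hx
      have hle (k : Fin ℓ) : f k (x k) ≤ (i : ℝ≥0) := by
        rw [hx]
        exact Nat.sSup_mem (h k) (bddAbove_sublevel_of_tendsto_atTop (htend k) i)
      calc F x = ∑ k, f k (x k) := hF x
        _ ≤ ∑ _k : Fin ℓ, (i : ℝ≥0) := Finset.sum_le_sum fun k _ => hle k
        _ = (ℓ : ℝ≥0) * (i : ℝ≥0) := by simp
    · simp [(hS i).2 h] at hx
end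

section
/- Let f₁, f₂ : ℕ → ℝ be ascending functions with f₁(x) ≥ 1 and f₂(x) ≥ 1 for all x, and define f : ℕ² → ℝ by f(x₁,x₂) = f₁(x₁)·f₂(x₂). Then there exists a bounded set-sequence (S(i))_{i∈ℕ} for f with bounding constant 4 such that |S(i)| ≤ ⌈log₂ i⌉ + 1 for every integer i ≥ 1. -/
/-- A nonempty sublevel set of a function `ℕ → ℝ` tending to infinity has its supremum as a
greatest element. -/
theorem le_sSup_sublevel_and_apply_le {f : ℕ → ℝ} (hf : Filter.Tendsto f Filter.atTop Filter.atTop)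
    {t : ℝ} {a : ℕ} (ha : f a ≤ t) :
    a ≤ sSup {x | f x ≤ t} ∧ f (sSup {x | f x ≤ t}) ≤ t := by
  have hbdd : BddAbove {x | f x ≤ t} := by
    obtain ⟨N, hN⟩ := Filter.eventually_atTop.1 (hf.eventually_gt_atTop t)
    exact ⟨N, fun x hx => le_of_not_gt fun h => (hN x h.le).not_ge hx⟩
  exact ⟨le_csSup hbdd ha, Nat.sSup_mem ⟨a, ha⟩ hbdd⟩

/-- For ascending functions `f₁, f₂ : ℕ → ℝ` with values at least `1`, the
product function `f(x₁,x₂) = f₁ x₁ * f₂ x₂` admits a bounded set-sequence with bounding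
constant `4` whose `i`-th set has cardinality at most `⌈log₂ i⌉ + 1` for every `i ≥ 1`. -/
theorem stmt1 (f₁ f₂ : ℕ → ℝ)
    (h₁mono : Monotone f₁) (h₂mono : Monotone f₂)
    (h₁tend : Filter.Tendsto f₁ Filter.atTop Filter.atTop)
    (h₂tend : Filter.Tendsto f₂ Filter.atTop Filter.atTop)
    (h₁one : ∀ x, 1 ≤ f₁ x) (h₂one : ∀ x, 1 ≤ f₂ x) :
    ∃ S : ℕ → Finset (ℕ × ℕ),
      (∀ i : ℕ, ∀ y : ℕ × ℕ, f₁ y.1 * f₂ y.2 ≤ (i : ℝ) →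
        ∃ x ∈ S i, y.1 ≤ x.1 ∧ y.2 ≤ x.2) ∧
      (∀ i : ℕ, ∀ x ∈ S i, f₁ x.1 * f₂ x.2 ≤ 4 * (i : ℝ)) ∧
      (∀ i : ℕ, 1 ≤ i → (S i).card ≤ ⌈Real.logb 2 i⌉₊ + 1) := by
  classical
  let g (f : ℕ → ℝ) (t : ℝ) : ℕ := sSup {x | f x ≤ t}
  refine ⟨fun i => ((Finset.range (⌈Real.logb 2 i⌉₊ + 1)).image
    fun j => (g f₁ (2 ^ (j + 1)), g f₂ (i / 2 ^ j))).filter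
      fun x => f₁ x.1 * f₂ x.2 ≤ 4 * (i : ℝ), ?_, ?_, ?_⟩
  · rintro i ⟨a, b⟩ hab
    dsimp only at hab
    have ha := h₁one a
    have hb := h₂one b
    obtain ⟨j, hj, hj'⟩ := exists_nat_pow_near ha (one_lt_two : (1 : ℝ) < 2)
    have hpos : (0 : ℝ) < 2 ^ j := by positivity
    have hji : (2 : ℝ) ^ j ≤ i := by nlinarith
    have hjlog : j ≤ ⌈Real.logb 2 i⌉₊ := by
      have h : (j : ℝ) ≤ Real.logb 2 i := by
        rw [Real.le_logb_iff_rpow_le one_lt_two (hpos.trans_le hji), Real.rpow_natCast]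
        exact hji
      exact_mod_cast h.trans (Nat.le_ceil _)
    have hb' : f₂ b ≤ i / 2 ^ j := by
      rw [le_div_iff₀ hpos]
      nlinarith
    obtain ⟨ha₁, ha₂⟩ := le_sSup_sublevel_and_apply_le h₁tend hj'.le
    obtain ⟨hb₁, hb₂⟩ := le_sSup_sublevel_and_apply_le h₂tend hb'
    refine ⟨(g f₁ (2 ^ (j + 1)), g f₂ (i / 2 ^ j)), ?_, ha₁, hb₁⟩
    refine Finset.mem_filter.2 ⟨Finset.mem_image.2
      ⟨j, Finset.mem_range.2 (Nat.lt_succ_of_le hjlog), rfl⟩, ?_⟩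
    calc f₁ (g f₁ (2 ^ (j + 1))) * f₂ (g f₂ (i / 2 ^ j))
        ≤ 2 ^ (j + 1) * (i / 2 ^ j) :=
          mul_le_mul ha₂ hb₂ (zero_le_one.trans (h₂one _)) (by positivity)
      _ = 2 * i := by field_simp; ring
      _ ≤ 4 * i := by gcongr; norm_num
  · intro i x hx
    exact (Finset.mem_filter.1 hx).2
  · intro i _
    exact (Finset.card_filter_le _ _).trans
      (Finset.card_image_le.trans (Finset.card_range _).le)
end

section
/- Let G be a finite simple graph, β ≥ 1 an integer, and ŷ : V(G) → {0,1} any labeling. Let W = W(ŷ) and let G' be the subgraph of G induced by V(G) \ W. If S' ⊆ V(G) \ W is a (2,β)-ruling set of G' (with distances measured in G'), then S' ∪ {u ∈ W : ŷ(u) = 1} is a (2,β)-ruling set of G. -/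
/-- `S` is a `(2,β)`-ruling set of `G`: `S` is independent and every vertex is at
distance at most `β` from some vertex of `S` (i.e. joined by a walk of length `≤ β`). -/
def IsRulingSet {V : Type*} (G : SimpleGraph V) (β : ℕ) (S : Set V) : Prop :=
  (∀ u ∈ S, ∀ v ∈ S, ¬ G.Adj u v) ∧
  ∀ u : V, ∃ v ∈ S, ∃ p : G.Walk u v, p.length ≤ β

/-- The set `W(ŷ)` of vertices pruned by the `(2,β)`-ruling set pruning algorithm. -/
def ruleprune {V : Type*} (G : SimpleGraph V) (β : ℕ) (y : V → Bool) : Set V :=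
  {u | (y u = true ∧ ∀ v, G.Adj u v → y v = false) ∨
       (y u = false ∧ ∃ v, (∃ p : G.Walk u v, p.length ≤ β) ∧
          y v = true ∧ ∀ w, G.Adj v w → y w = false)}

/-- The selected vertices with no selected neighbour are exactly the selected pruned vertices. -/
theorem mem_ruleprune_of_eq_true {V : Type*} {G : SimpleGraph V} {β : ℕ} {y : V → Bool} {u : V}
    (hu : y u = true) : u ∈ ruleprune G β y ↔ ∀ v, G.Adj u v → y v = false := by
  simp [ruleprune, hu]

/-- Every neighbour of a selected pruned vertex is pruned. -/
theorem mem_ruleprune_of_adj {V : Type*} {G : SimpleGraph V} {β : ℕ} (hβ : 1 ≤ β)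
    {y : V → Bool} {u v : V} (hv : v ∈ ruleprune G β y) (hyv : y v = true) (huv : G.Adj u v) :
    u ∈ ruleprune G β y := by
  have h := (mem_ruleprune_of_eq_true hyv).1 hv
  exact Or.inr ⟨h u huv.symm, v, ⟨huv.toWalk, by simpa using hβ⟩, hyv, h⟩

/-- gluing: if `W = W(ŷ)` and `S'` is a `(2,β)`-ruling set of the subgraph
of `G` induced by `V(G) \ W`, then `S' ∪ {u ∈ W : ŷ u = 1}` is a `(2,β)`-ruling set of `G`. -/
theorem stmt6 {V : Type*} [Fintype V] (G : SimpleGraph V) (β : ℕ) (hβ : 1 ≤ β)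
    (y : V → Bool) (W : Set V) (hW : W = ruleprune G β y)
    (S' : Set ↥(Wᶜ)) (hS' : IsRulingSet (G.induce Wᶜ) β S') :
    IsRulingSet G β ((Subtype.val '' S') ∪ {u | u ∈ W ∧ y u = true}) := by
  subst hW
  obtain ⟨hind, hdom⟩ := hS'
  refine ⟨?_, fun u ↦ ?_⟩
  · rintro _ (⟨u, hu, rfl⟩ | ⟨hu, hyu⟩) _ (⟨v, hv, rfl⟩ | ⟨hv, hyv⟩) huv
    · exact hind u hu v hv huv
    · exact u.2 (mem_ruleprune_of_adj hβ hv hyv huv)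
    · exact v.2 (mem_ruleprune_of_adj hβ hu hyu huv.symm)
    · simp [(mem_ruleprune_of_eq_true hyu).1 hu _ huv] at hyv
  · by_cases hu : u ∈ ruleprune G β y
    · rcases id hu with ⟨hyu, -⟩ | ⟨-, v, hp, hyv, hv⟩
      · exact ⟨u, Or.inr ⟨hu, hyu⟩, .nil, by simp⟩
      · exact ⟨v, Or.inr ⟨(mem_ruleprune_of_eq_true hyv).2 hv, hyv⟩, hp⟩
    · obtain ⟨v, hv, p, hp⟩ := hdom ⟨u, hu⟩
      exact ⟨v, Or.inl ⟨v, hv, rfl⟩, p.map (SimpleGraph.Embedding.induce _).toHom,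
        (SimpleGraph.Walk.length_map _ p).trans_le hp⟩
end

section
/- Let g : ℕ → ℝ>0 be non-decreasing and let α be a positive integer such that g(α·i) ≥ 2·g(i) and α·g(i) ≥ g(2·i) for every integer i ≥ 1. Define D₁ = 1 and D_{i+1} = min{ℓ ∈ ℕ : g(ℓ) ≥ 2·g(D_i)} for i ≥ 1. Then each D_{i+1} is well defined (the minimized set is nonempty), and for every i ≥ 1: D_i < D_{i+1} ≤ α·D_i and g(D_{i+1}) ≤ α^{⌈log₂ α⌉}·g(D_i). -/
/-- Iterating the doubling bound `g (2 * i) ≤ a * g i` for `k` steps. -/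
theorem apply_two_pow_mul_le {g : ℕ → ℝ} {a : ℝ} (ha : 0 ≤ a)
    (h : ∀ i : ℕ, 1 ≤ i → g (2 * i) ≤ a * g i) (k : ℕ) {n : ℕ} (hn : 1 ≤ n) :
    g (2 ^ k * n) ≤ a ^ k * g n := by
  induction k with
  | zero => simp
  | succ k ih =>
    calc g (2 ^ (k + 1) * n) = g (2 * (2 ^ k * n)) := by rw [pow_succ', mul_assoc]
      _ ≤ a * g (2 ^ k * n) := h _ (Nat.mul_pos (by positivity) hn)
      _ ≤ a * (a ^ k * g n) := by gcongr
      _ = a ^ (k + 1) * g n := by ring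


/-- Let `g : ℕ → ℝ` be positive and non-decreasing, and let `α` be a
positive integer with `g(α·i) ≥ 2·g(i)` and `α·g(i) ≥ g(2·i)` for every `i ≥ 1`.
Define `D₁ = 1` and `D_{i+1} = min {ℓ : g(ℓ) ≥ 2·g(D_i)}`. Then each `D_{i+1}` is well
defined (the minimized set is nonempty) and, for every `i ≥ 1`,
`D_i < D_{i+1} ≤ α·D_i` and `g(D_{i+1}) ≤ α^{⌈log₂ α⌉}·g(D_i)`. -/
theorem stmt15 (g : ℕ → ℝ) (hgpos : ∀ i, 0 < g i) (hgmono : Monotone g)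
    (α : ℕ) (hα : 0 < α)
    (h1 : ∀ i : ℕ, 1 ≤ i → 2 * g i ≤ g (α * i))
    (h2 : ∀ i : ℕ, 1 ≤ i → g (2 * i) ≤ (α : ℝ) * g i)
    (D : ℕ → ℕ) (hD1 : D 1 = 1)
    (hDrec : ∀ i : ℕ, 1 ≤ i → D (i + 1) = sInf {ℓ : ℕ | 2 * g (D i) ≤ g ℓ}) :
    ∀ i : ℕ, 1 ≤ i →
      ({ℓ : ℕ | 2 * g (D i) ≤ g ℓ}).Nonempty ∧
      D i < D (i + 1) ∧
      D (i + 1) ≤ α * D i ∧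
      g (D (i + 1)) ≤ (α : ℝ) ^ (Nat.clog 2 α) * g (D i) := by
  have key : ∀ i : ℕ, 1 ≤ i → 1 ≤ D i →
      ({ℓ : ℕ | 2 * g (D i) ≤ g ℓ}).Nonempty ∧
      D i < D (i + 1) ∧
      D (i + 1) ≤ α * D i ∧
      g (D (i + 1)) ≤ (α : ℝ) ^ (Nat.clog 2 α) * g (D i) := by
    intro i hi hDi
    have hmem : α * D i ∈ {ℓ : ℕ | 2 * g (D i) ≤ g ℓ} := h1 _ hDi
    have hle : D (i + 1) ≤ α * D i := hDrec i hi ▸ Nat.sInf_le hmem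
    have hdouble : 2 * g (D i) ≤ g (D (i + 1)) := by
      rw [hDrec i hi]
      exact Nat.sInf_mem ⟨_, hmem⟩
    refine ⟨⟨_, hmem⟩, ?_, hle, ?_⟩
    · by_contra! hlt
      linarith [hgmono hlt, hgpos (D i)]
    · calc g (D (i + 1)) ≤ g (2 ^ Nat.clog 2 α * D i) :=
            hgmono (hle.trans (Nat.mul_le_mul_right _ (Nat.le_pow_clog one_lt_two α)))
        _ ≤ (α : ℝ) ^ Nat.clog 2 α * g (D i) :=
            apply_two_pow_mul_le (Nat.cast_nonneg α) h2 _ hDi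
  have hDpos : ∀ i : ℕ, 1 ≤ i → 1 ≤ D i := by
    intro i hi
    induction i, hi using Nat.le_induction with
    | base => exact hD1.ge
    | succ i hi ih => exact ih.trans (key i hi ih).2.1.le
  exact fun i hi => key i hi (hDpos i hi)
end

section
/- Let ℓ and t be positive integers, let f : ℕ^ℓ → ℝ be non-decreasing (f(y) ≤ f(x) whenever x dominates y), and let (S(i))_{i∈ℕ} be a bounded set-sequence for f with bounding constant c. Let h : {1,…,t} → {1,…,ℓ} be any map and let g₁,…,g_t : ℕ → ℕ be ascending functions. Define f' : ℕ^{ℓ} × ℕ^{t} → ℝ by f'(x₁,…,x_ℓ,y₁,…,y_t) = f(z₁,…,z_ℓ), where z_i = max({x_i} ∪ {g_k(y_k) : k ∈ {1,…,t} with h(k) = i}). Then there exists a bounded set-sequence (S'(i))_{i∈ℕ} for f' with bounding constant c such that |S'(i)| ≤ |S(i)| for every i ∈ ℕ. -/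
/-- An unbounded monotone sequence `g` has a largest index below every threshold `m ≥ g 0`. -/
theorem exists_forall_le_iff_apply_le {g : ℕ → ℕ} (hmono : Monotone g)
    (htend : Filter.Tendsto g Filter.atTop Filter.atTop) (m : ℕ) (h0 : g 0 ≤ m) :
    ∃ N, ∀ n, n ≤ N ↔ g n ≤ m := by
  obtain ⟨b, hb⟩ := (htend.eventually_gt_atTop m).exists
  have hlt : ∀ n, g n ≤ m → n ≤ b := fun n hn => by
    by_contra! hbn
    exact absurd (hmono hbn.le) (by omega)
  exact ⟨Nat.findGreatest (fun n => g n ≤ m) b, fun n =>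
    ⟨fun hn => (hmono hn).trans (Nat.findGreatest_spec (P := fun n => g n ≤ m) b.zero_le h0),
      fun hn => Nat.le_findGreatest (hlt n hn) hn⟩⟩


/-- Let `f : ℕ^ℓ → ℝ` be non-decreasing with a bounded set-sequence `S`
with bounding constant `c`, let `h : {1,…,t} → {1,…,ℓ}` and let `g₁,…,g_t` be ascending
functions `ℕ → ℕ`. Define `f'(x,y) = f(z)` where
`z_i = max({x_i} ∪ {g_k(y_k) : h(k) = i})`. Then `f'` admits a bounded set-sequence `S'`
with bounding constant `c` such that `|S'(i)| ≤ |S(i)|` for every `i`. -/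
theorem stmt19 (ℓ t : ℕ) (hℓ : 0 < ℓ) (ht : 0 < t)
    (f : (Fin ℓ → ℕ) → ℝ)
    (hfmono : ∀ x y : Fin ℓ → ℕ, (∀ k, y k ≤ x k) → f y ≤ f x)
    (c : ℝ) (S : ℕ → Finset (Fin ℓ → ℕ))
    (hSseq : ∀ i : ℕ, ∀ y : Fin ℓ → ℕ, f y ≤ (i : ℝ) → ∃ x ∈ S i, ∀ k, y k ≤ x k)
    (hSbd : ∀ i : ℕ, ∀ x ∈ S i, f x ≤ c * (i : ℝ))
    (h : Fin t → Fin ℓ) (g : Fin t → ℕ → ℕ)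
    (hgmono : ∀ k, Monotone (g k))
    (hgtend : ∀ k, Filter.Tendsto (g k) Filter.atTop Filter.atTop)
    (f' : (Fin ℓ → ℕ) → (Fin t → ℕ) → ℝ)
    (hf' : ∀ (x : Fin ℓ → ℕ) (y : Fin t → ℕ), f' x y =
      f (fun i => max (x i)
        ((Finset.univ.filter (fun k => h k = i)).sup (fun k => g k (y k))))) :
    ∃ S' : ℕ → Finset ((Fin ℓ → ℕ) × (Fin t → ℕ)),
      (∀ i : ℕ, ∀ p : (Fin ℓ → ℕ) × (Fin t → ℕ), f' p.1 p.2 ≤ (i : ℝ) →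
        ∃ q ∈ S' i, (∀ k, p.1 k ≤ q.1 k) ∧ (∀ k, p.2 k ≤ q.2 k)) ∧
      (∀ i : ℕ, ∀ q ∈ S' i, f' q.1 q.2 ≤ c * (i : ℝ)) ∧
      (∀ i : ℕ, (S' i).card ≤ (S i).card) := by
  classical
  choose! N hN using fun k => exists_forall_le_iff_apply_le (hgmono k) (hgtend k)
  refine ⟨fun i => ((S i).filter fun x => ∀ k, g k 0 ≤ x (h k)).image
    fun x => (x, fun k => N k (x (h k))), ?_, ?_, ?_⟩
  · rintro i ⟨x, y⟩ hxy
    rw [hf'] at hxy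
    obtain ⟨w, hwS, hw⟩ := hSseq i _ hxy
    have hgw : ∀ k, g k (y k) ≤ w (h k) := fun k =>
      (Finset.le_sup (f := fun k => g k (y k)) (by simp)).trans
        ((le_max_right _ _).trans (hw (h k)))
    have h0 : ∀ k, g k 0 ≤ w (h k) := fun k => (hgmono k (Nat.zero_le _)).trans (hgw k)
    exact ⟨_, Finset.mem_image_of_mem _ (Finset.mem_filter.2 ⟨hwS, h0⟩),
      fun k => (le_max_left _ _).trans (hw k), fun k => (hN k _ (h0 k) _).2 (hgw k)⟩
  · intro i q hq
    obtain ⟨w, hw, rfl⟩ := Finset.mem_image.1 hq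
    obtain ⟨hwS, h0⟩ := Finset.mem_filter.1 hw
    rw [hf']
    refine (hfmono w _ fun j => max_le le_rfl (Finset.sup_le fun k hk => ?_)).trans (hSbd i w hwS)
    obtain rfl := (Finset.mem_filter.1 hk).2
    exact (hN k _ (h0 k) _).1 le_rfl
  · exact fun i => Finset.card_image_le.trans (Finset.card_filter_le _ _)
end
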